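/- Let k be a field of characteristic different from 2, and let R = k[x₁, …, xₙ]/(x₁², …, xₙ²). Then cs(R) = n − 1. -/

import Mathlib

/-- The minimal number of generators of an ideal. -/
noncomputable def mu {R : Type*} [CommRing R] (I : Ideal R) : ℕ :=
  sInf {m : ℕ | ∃ s : Finset R, s.card = m ∧ Ideal.span (s : Set R) = I}

/-- The image `m̄` of the irrelevant maximal ideal `m = (x₁, …, xₙ)` in the quotient
`k[x₁, …, xₙ]/I`. -/
noncomputable def mbar {k : Type*} [Field k] {n : ℕ}
    (I : Ideal (MvPolynomial (Fin n) k)) : Ideal (MvPolynomial (Fin n) k ⧸ I) :=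
  Ideal.map (Ideal.Quotient.mk I)
    (Ideal.span (Set.range (MvPolynomial.X : Fin n → MvPolynomial (Fin n) k)))

/-- An ideal of the quotient `k[x₁, …, xₙ]/I` is homogeneous if it is generated by the
images of a set of homogeneous polynomials. -/
def IsHomogeneousQuotIdeal {k : Type*} [Field k] {n : ℕ}
    (I : Ideal (MvPolynomial (Fin n) k))
    (J : Ideal (MvPolynomial (Fin n) k ⧸ I)) : Prop :=
  ∃ T : Set (MvPolynomial (Fin n) k),
    (∀ p ∈ T, ∃ d : ℕ, MvPolynomial.IsHomogeneous p d) ∧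
    J = Ideal.map (Ideal.Quotient.mk I) (Ideal.span T)

/-- `cs` of the standard graded algebra `k[x₁, …, xₙ]/I`:
the minimum of `μ(J)` over the homogeneous ideals `J ⊆ m̄` with `J² = m̄²`. -/
noncomputable def csGr {k : Type*} [Field k] {n : ℕ}
    (I : Ideal (MvPolynomial (Fin n) k)) : ℕ :=
  sInf {m : ℕ | ∃ J : Ideal (MvPolynomial (Fin n) k ⧸ I),
    IsHomogeneousQuotIdeal I J ∧ J ≤ mbar I ∧ J ^ 2 = (mbar I) ^ 2 ∧ mu J = m}

open MvPolynomial in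
lemma aux_upper {A : Type*} [CommRing A] {n : ℕ} (x : Fin (n+1) → A) (hx : ∀ i, x i ^ 2 = 0)
    (c : A) (hc : c * 2 = 1) :
    (Ideal.span (Set.range x)) ^ 2 ≤
      (Ideal.span (Set.range fun i : Fin n => x i.castSucc - x (Fin.last n))) ^ 2 := by
  set J := Ideal.span (Set.range fun i : Fin n => x i.castSucc - x (Fin.last n)) with hJ
  have hmem : ∀ i : Fin n, x i.castSucc - x (Fin.last n) ∈ J := fun i =>
    Ideal.subset_span ⟨i, rfl⟩
  have hprod : ∀ i j : Fin n,
      (x i.castSucc - x (Fin.last n)) * (x j.castSucc - x (Fin.last n)) ∈ J ^ 2 := by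
    intro i j
    rw [pow_two]
    exact Ideal.mul_mem_mul (hmem i) (hmem j)
  have h1 : ∀ i : Fin n, x i.castSucc * x (Fin.last n) ∈ J ^ 2 := by
    intro i
    have := (J ^ 2).mul_mem_left (-c) (hprod i i)
    convert this using 1
    linear_combination (-(x i.castSucc * x (Fin.last n))) * hc + c * hx i.castSucc
      + c * hx (Fin.last n)
  have h2 : ∀ i j : Fin n, x i.castSucc * x j.castSucc ∈ J ^ 2 := by
    intro i j
    have := (J ^ 2).add_mem (hprod i j) ((J ^ 2).add_mem (h1 i) (h1 j))
    convert this using 1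
    linear_combination (-1 : A) * hx (Fin.last n)
  rw [pow_two (Ideal.span _), Ideal.span_mul_span', Ideal.span_le]
  rintro _ ⟨_, ⟨i, rfl⟩, _, ⟨j, rfl⟩, rfl⟩
  show x i * x j ∈ J ^ 2
  induction i using Fin.lastCases with
  | last =>
    induction j using Fin.lastCases with
    | last => rw [← pow_two, hx]; exact zero_mem _
    | cast j => rw [mul_comm]; exact h1 j
  | cast i =>
    induction j using Fin.lastCases with
    | last => exact h1 i
    | cast j => exact h2 i j

lemma mu_le {R : Type*} [CommRing R] (s : Finset R) (I : Ideal R)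
    (h : Ideal.span (s : Set R) = I) : mu I ≤ s.card :=
  Nat.sInf_le ⟨s, rfl, h⟩

lemma mu_spec {R : Type*} [CommRing R] [IsNoetherianRing R] (I : Ideal R) :
    ∃ s : Finset R, s.card = mu I ∧ Ideal.span (s : Set R) = I := by
  obtain ⟨s, hs⟩ := (isNoetherianRing_iff_ideal_fg R).1 inferInstance I
  exact Nat.sInf_mem (s := {m : ℕ | ∃ s : Finset R, s.card = m ∧ Ideal.span (s : Set R) = I})
    ⟨s.card, s, rfl, hs⟩

open MvPolynomial in
/-- exponent vector of a squarefree monomial -/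
noncomputable def eT {n : ℕ} (T : Finset (Fin n)) : Fin n →₀ ℕ := Finsupp.indicator T (fun _ _ => 1)

lemma eT_apply {n : ℕ} (T : Finset (Fin n)) (i : Fin n) : eT T i = if i ∈ T then 1 else 0 := by
  simp [eT, Finsupp.indicator_apply]

lemma eT_inj {n : ℕ} {T U : Finset (Fin n)} (h : eT T = eT U) : T = U := by
  ext i
  have := DFunLike.congr_fun h i
  rw [eT_apply, eT_apply] at this
  by_cases h1 : i ∈ T <;> by_cases h2 : i ∈ U <;> simp_all

lemma eT_degree {n : ℕ} (T : Finset (Fin n)) : (eT T).degree = T.card := by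
  rw [Finsupp.degree_eq_sum]
  simp [eT_apply]

abbrev Pr (n : ℕ) := {T : Finset (Fin n) // T ∈ Finset.powersetCard 2 (Finset.univ : Finset (Fin n))}

noncomputable def Phi (k : Type*) [Field k] (n : ℕ) : MvPolynomial (Fin n) k →ₗ[k] (Pr n → k) :=
  LinearMap.pi fun T => MvPolynomial.lcoeff k (eT T.1)

lemma Phi_apply {k : Type*} [Field k] {n : ℕ} (p : MvPolynomial (Fin n) k) (T : Pr n) :
    Phi k n p T = MvPolynomial.coeff (eT T.1) p := rfl

open MvPolynomial in
lemma Phi_I {k : Type*} [Field k] {n : ℕ} {p : MvPolynomial (Fin n) k}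
    (hp : p ∈ Ideal.span (Set.range (fun i : Fin n => (X i : MvPolynomial (Fin n) k) ^ 2))) :
    Phi k n p = 0 := by
  induction hp using Submodule.span_induction with
  | mem x h => 
    obtain ⟨i, rfl⟩ := h
    ext T
    rw [Phi_apply]
    simp only [X_pow_eq_monomial, coeff_monomial, Pi.zero_apply]
    rw [if_neg]
    intro h
    have := DFunLike.congr_fun h i
    rw [eT_apply] at this
    simp at this
    split_ifs at this <;> omega
  | zero => simp
  | add x y _ _ h1 h2 => rw [map_add, h1, h2, add_zero]
  | smul a x hx _ =>
    ext T
    obtain ⟨c, rfl⟩ := (Ideal.mem_span_range_iff_exists_fun).1 hx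
    rw [Phi_apply, smul_eq_mul, Finset.mul_sum, coeff_sum]
    apply Finset.sum_eq_zero
    intro i _
    rw [← mul_assoc, X_pow_eq_monomial, coeff_mul_monomial', if_neg]
    intro h
    have := h i
    rw [eT_apply] at this
    simp at this
    split_ifs at this <;> omega

open MvPolynomial in
lemma Phi_m3 {k : Type*} [Field k] {n : ℕ} {p : MvPolynomial (Fin n) k}
    (hp : p ∈ (Ideal.span (Set.range (X : Fin n → MvPolynomial (Fin n) k))) ^ 3) :
    Phi k n p = 0 := by
  ext T
  rw [Phi_apply]
  by_contra h
  have h3 := (mem_pow_idealOfVars_iff 3 p).1 hp (eT T.1) (by simpa using h)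
  rw [eT_degree, (Finset.mem_powersetCard.1 T.2).2] at h3
  omega

open MvPolynomial in
lemma Phi_m2 {k : Type*} [Field k] {n : ℕ} (f : Pr n → k) :
    ∃ p ∈ (Ideal.span (Set.range (X : Fin n → MvPolynomial (Fin n) k))) ^ 2,
    Phi k n p = f := by
  classical
  refine ⟨∑ T : Pr n, monomial (eT T.1) (f T), ?_, ?_⟩
  · refine sum_mem fun T _ => ?_
    refine (mem_pow_idealOfVars_iff 2 _).2 fun x hx => ?_
    have := support_monomial_subset hx
    rw [Finset.mem_singleton] at this
    rw [this, eT_degree, (Finset.mem_powersetCard.1 T.2).2]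
  · ext U
    rw [Phi_apply, coeff_sum, Finset.sum_eq_single U]
    · simp
    · intro T _ hT
      rw [coeff_monomial, if_neg]
      exact fun h => hT (Subtype.ext (eT_inj h))
    · simp

open MvPolynomial in
lemma aux_lower {k : Type*} [Field k] {n : ℕ} (s : Finset (MvPolynomial (Fin n) k))
    (hs : ∀ p ∈ s, p ∈ Ideal.span (Set.range (X : Fin n → MvPolynomial (Fin n) k)))
    (h : (Ideal.span (Set.range (X : Fin n → MvPolynomial (Fin n) k))) ^ 2 ≤
      (Ideal.span (s : Set (MvPolynomial (Fin n) k))) ^ 2 ⊔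
      Ideal.span (Set.range (fun i : Fin n => (X i : MvPolynomial (Fin n) k) ^ 2))) :
    n - 1 ≤ s.card := by
  classical
  set m := Ideal.span (Set.range (X : Fin n → MvPolynomial (Fin n) k)) with hm
  let g : Sym2 (MvPolynomial (Fin n) k) → (Pr n → k) :=
    fun z => Phi k n (Sym2.lift ⟨fun a b => a * b, fun a b => mul_comm a b⟩ z)
  let F : Finset (Pr n → k) := s.sym2.image g
  have key : ∀ y ∈ (Ideal.span (s : Set (MvPolynomial (Fin n) k))) ^ 2,
      Phi k n y ∈ Submodule.span k (F : Set (Pr n → k)) := by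
    intro y hy
    rw [pow_two, Ideal.span_mul_span'] at hy
    induction hy using Submodule.closure_induction with
    | zero => simp
    | add x y _ _ h1 h2 => rw [map_add]; exact add_mem h1 h2
    | smul_mem c x hx =>
      obtain ⟨a, ha, b, hb, rfl⟩ := hx
      have hc : c - C (constantCoeff c) ∈ m := by
        have : c - C (constantCoeff c) ∈ (idealOfVars (Fin n) k) ^ 1 := by
          rw [mem_pow_idealOfVars_iff]
          intro x hx
          by_contra hlt
          have : x = 0 := by
            rw [← Finsupp.degree_eq_zero_iff]; omega
          subst this
          simp [constantCoeff_eq] at hx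
        rwa [pow_one] at this
      have e : c • (a * b) = (constantCoeff c) • (a * b) + (c - C (constantCoeff c)) * (a * b) := by
        rw [smul_eq_C_mul, smul_eq_mul]; ring
      show Phi k n (c • (a * b)) ∈ _
      rw [e, map_add, map_smul]
      have h0 : Phi k n ((c - C (constantCoeff c)) * (a * b)) = 0 := by
        apply Phi_m3
        rw [pow_succ', pow_two]
        exact Ideal.mul_mem_mul hc (Ideal.mul_mem_mul (hs a ha) (hs b hb))
      rw [h0, add_zero]
      refine Submodule.smul_mem _ _ (Submodule.subset_span ?_)
      refine Finset.mem_coe.2 (Finset.mem_image.2 ⟨s(a, b), ?_, rfl⟩)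
      exact Finset.mk_mem_sym2_iff.2 ⟨ha, hb⟩
  have htop : Submodule.span k (F : Set (Pr n → k)) = ⊤ := by
    rw [eq_top_iff]
    intro f _
    obtain ⟨p, hp, rfl⟩ := Phi_m2 f
    obtain ⟨y, hy, z, hz, rfl⟩ := Submodule.mem_sup.1 (h hp)
    rw [map_add, Phi_I hz, add_zero]
    exact key y hy
  have h1 : Module.finrank k (Pr n → k) ≤ F.card := by
    rw [← finrank_top, ← htop]
    exact finrank_span_finset_le_card F
  have h2 : F.card ≤ (s.card + 1).choose 2 :=
    Finset.card_image_le.trans (Finset.card_sym2 s).le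
  have h3 : Module.finrank k (Pr n → k) = n.choose 2 := by
    rw [Module.finrank_fintype_fun_eq_card, Fintype.card_coe, Finset.card_powersetCard]
    simp
  by_contra hlt
  have h4 : (s.card + 1).choose 2 < n.choose 2 := by
    have h5 : (s.card + 2).choose 2 ≤ n.choose 2 := Nat.choose_le_choose 2 (by omega)
    have h6 : (s.card + 2).choose 2 = (s.card + 1).choose 1 + (s.card + 1).choose 2 :=
      Nat.choose_succ_succ _ _
    rw [Nat.choose_one_right] at h6
    omega
  omega

open MvPolynomial in
lemma lower {k : Type*} [Field k] {n : ℕ} (I : Ideal (MvPolynomial (Fin n) k))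
    (hI : I = Ideal.span
      (Set.range (fun i : Fin n => (MvPolynomial.X i : MvPolynomial (Fin n) k) ^ 2)))
    (J : Ideal (MvPolynomial (Fin n) k ⧸ I))
    (h1 : J ≤ mbar I) (h2 : J ^ 2 = (mbar I) ^ 2) : n - 1 ≤ mu J := by
  classical
  obtain ⟨s, hs, hsJ⟩ := mu_spec J
  obtain ⟨g, hg⟩ := (Ideal.Quotient.mk_surjective (I := I)).hasRightInverse
  have hmap : Ideal.map (Ideal.Quotient.mk I) (Ideal.span ((s.image g : Finset _) : Set _)) = J := by
    rw [Ideal.map_span, ← hsJ, Finset.coe_image, Set.image_image]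
    simp [hg _]
  have hIm : I ≤ Ideal.span (Set.range (X : Fin n → MvPolynomial (Fin n) k)) := by
    rw [hI, Ideal.span_le]
    rintro _ ⟨i, rfl⟩
    exact Ideal.pow_mem_of_mem _ (Ideal.subset_span (Set.mem_range_self i)) 2 (by norm_num)
  rw [← hs]
  refine le_trans (aux_lower (s.image g) ?_ ?_) Finset.card_image_le
  · intro p hp
    obtain ⟨a, ha, rfl⟩ := Finset.mem_image.1 hp
    have : Ideal.Quotient.mk I (g a) ∈ mbar I := by
      rw [hg a]
      exact h1 (hsJ ▸ Ideal.subset_span ha)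
    have h3 : g a ∈ Ideal.comap (Ideal.Quotient.mk I) (mbar I) := this
    rw [mbar, Ideal.comap_map_of_surjective' _ Ideal.Quotient.mk_surjective, Ideal.mk_ker,
      sup_eq_left.2 hIm] at h3
    exact h3
  · rw [← hmap, mbar, ← Ideal.map_pow, ← Ideal.map_pow] at h2
    have h3 := Ideal.map_le_iff_le_comap.1 h2.ge
    rw [Ideal.comap_map_of_surjective' _ Ideal.Quotient.mk_surjective, Ideal.mk_ker] at h3
    exact h3.trans (sup_le_sup_left hI.le _)

open MvPolynomial in
lemma upper {k : Type*} [Field k] (hchar : ringChar k ≠ 2) (n : ℕ) :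
    ∃ J : Ideal (MvPolynomial (Fin n) k ⧸ Ideal.span
      (Set.range (fun i : Fin n => (MvPolynomial.X i : MvPolynomial (Fin n) k) ^ 2))),
      IsHomogeneousQuotIdeal _ J ∧ J ≤ mbar _ ∧ J ^ 2 = (mbar _) ^ 2 ∧ mu J ≤ n - 1 := by
  classical
  set I := Ideal.span
      (Set.range (fun i : Fin n => (MvPolynomial.X i : MvPolynomial (Fin n) k) ^ 2)) with hI
  cases n with
  | zero =>
    refine ⟨mbar I, ⟨Set.range X, ?_, rfl⟩, le_rfl, rfl, ?_⟩
    · rintro _ ⟨i, rfl⟩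
      exact i.elim0
    · refine mu_le ∅ _ ?_
      simp [mbar]
  | succ n =>
    let t : Fin n → MvPolynomial (Fin (n+1)) k := fun i => X i.castSucc - X (Fin.last n)
    have hm : mbar I = Ideal.span (Set.range fun i => Ideal.Quotient.mk I (X i)) := by
      rw [mbar, Ideal.map_span, ← Set.range_comp]; rfl
    have hJ : Ideal.map (Ideal.Quotient.mk I) (Ideal.span (Set.range t)) =
        Ideal.span (Set.range fun i : Fin n => Ideal.Quotient.mk I (X i.castSucc)
          - Ideal.Quotient.mk I (X (Fin.last n))) := by
      rw [Ideal.map_span, ← Set.range_comp]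
      simp [t, Function.comp_def]
    have hle : Ideal.map (Ideal.Quotient.mk I) (Ideal.span (Set.range t)) ≤ mbar I := by
      apply Ideal.map_mono
      rw [Ideal.span_le]
      rintro _ ⟨i, rfl⟩
      exact sub_mem (Ideal.subset_span ⟨_, rfl⟩) (Ideal.subset_span ⟨_, rfl⟩)
    refine ⟨Ideal.map (Ideal.Quotient.mk I) (Ideal.span (Set.range t)),
      ⟨Set.range t, ?_, rfl⟩, hle, le_antisymm (Ideal.pow_right_mono hle 2) ?_, ?_⟩
    · rintro _ ⟨i, rfl⟩
      exact ⟨1, (isHomogeneous_X _ _).sub (isHomogeneous_X _ _)⟩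
    · rw [hm, hJ]
      have h2 : (2 : k) ≠ 0 := Ring.two_ne_zero hchar
      refine aux_upper (fun i => Ideal.Quotient.mk I (X i)) ?_
        (Ideal.Quotient.mk I (C (2⁻¹ : k))) ?_
      · intro i
        rw [← map_pow, Ideal.Quotient.eq_zero_iff_mem]
        exact Ideal.subset_span ⟨i, rfl⟩
      · have : (C (2⁻¹ : k) : MvPolynomial (Fin (n+1)) k) * 2 = 1 := by
          rw [show (2 : MvPolynomial (Fin (n+1)) k) = C 2 from (map_ofNat C 2).symm, ← C_mul,
            inv_mul_cancel₀ h2, C_1]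
        rw [← map_ofNat (Ideal.Quotient.mk I) 2, ← map_mul, this, map_one]
    · refine (mu_le (Finset.univ.image fun i : Fin n => Ideal.Quotient.mk I (X i.castSucc)
          - Ideal.Quotient.mk I (X (Fin.last n))) _ ?_).trans ?_
      · rw [hJ]; simp
      · exact Finset.card_image_le.trans (by simp)

/-- Let `k` be a field of characteristic different from 2 and let
`R = k[x₁, …, xₙ]/(x₁², …, xₙ²)`.  Then `cs(R) = n − 1`. -/
theorem stmt17 {k : Type*} [Field k] (hchar : ringChar k ≠ 2) (n : ℕ) :
    csGr (Ideal.span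
      (Set.range (fun i : Fin n => (MvPolynomial.X i : MvPolynomial (Fin n) k) ^ 2)))
      = n - 1 := by
  obtain ⟨J, hJ1, hJ2, hJ3, hJ4⟩ := upper hchar n
  apply le_antisymm
  · refine le_trans ?_ hJ4
    exact Nat.sInf_le ⟨J, hJ1, hJ2, hJ3, rfl⟩
  · refine le_csInf ⟨_, J, hJ1, hJ2, hJ3, rfl⟩ ?_
    rintro m ⟨J', _, h2, h3, rfl⟩
    exact lower _ rfl J' h2 h3
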